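/- Let n ≥ 1, let 0 ≤ k ≤ n be an integer, let m be a positive even integer, and let a ∈ ½ℤ with a ≥ 0. Then, as an identity of rational functions in ℚ(x_1^{1/2},…,x_n^{1/2}), the sum of the intermediate symplectic characters sp^{(k,n−k)}_{λ+(a^n)}(x_1,…,x_k | x_{k+1},…,x_n) over all partitions λ ∈ Even((m^n)) equals sp_{((m/2)^n)}(x_1,…,x_n) · sp_{((m/2+a)^k)}(x_1,…,x_k) · (x_{k+1}⋯x_n)^{m/2+a}. -/

import Mathlib

open Matrix BigOperators
open scoped Classical

noncomputable section

/-- The field `ℚ(t_1, …, t_n)` of rational functions in `n` indeterminates over `ℚ`. -/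
abbrev FF (n : ℕ) : Type := FractionRing (MvPolynomial (Fin n) ℚ)

/-- The `i`-th indeterminate, viewed as an element of `FF n`. -/
def gen (n : ℕ) (i : Fin n) : FF n :=
  algebraMap (MvPolynomial (Fin n) ℚ) (FF n) (MvPolynomial.X i)

variable {F : Type*} [Field F]

/-- Symplectic character `sp_λ(x_1, …, x_N)`, in "doubled" form: `z i` represents
`x_i^{1/2}` and `μ i` represents `2·λ_i` (so half-integer weights are allowed). -/
def spD {N : ℕ} (z : Fin N → F) (μ : Fin N → ℤ) : F :=
  Matrix.det (Matrix.of fun i j : Fin N =>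
      z j ^ (μ i + 2 * ((N : ℤ) - (i : ℕ))) - z j ^ (-(μ i + 2 * ((N : ℤ) - (i : ℕ))))) /
  Matrix.det (Matrix.of fun i j : Fin N =>
      z j ^ (2 * ((N : ℤ) - (i : ℕ))) - z j ^ (-(2 * ((N : ℤ) - (i : ℕ)))))

/-- Odd orthogonal character `so^B_λ(x_1, …, x_N)`, in "doubled" form: `z i` represents
`x_i^{1/2}` and `μ i` represents `2·λ_i`. -/
def soBD {N : ℕ} (z : Fin N → F) (μ : Fin N → ℤ) : F :=
  Matrix.det (Matrix.of fun i j : Fin N =>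
      z j ^ (μ i + 2 * ((N : ℤ) - (i : ℕ)) - 1) -
        z j ^ (-(μ i + 2 * ((N : ℤ) - (i : ℕ)) - 1))) /
  Matrix.det (Matrix.of fun i j : Fin N =>
      z j ^ (2 * ((N : ℤ) - (i : ℕ)) - 1) - z j ^ (-(2 * ((N : ℤ) - (i : ℕ)) - 1)))

/-- Even orthogonal character `so^D_λ(x_1, …, x_N)`, in "doubled" form: `z i` represents
`x_i^{1/2}` and `μ i` represents `2·λ_i`; the factor is `2` if `λ_N > 0` and `1` otherwise. -/
def soDD {N : ℕ} (z : Fin N → F) (μ : Fin N → ℤ) : F :=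
  (if h : 0 < N then (if 0 < μ ⟨N - 1, Nat.sub_lt h Nat.one_pos⟩ then (2 : F) else 1) else 1) *
  (Matrix.det (Matrix.of fun i j : Fin N =>
      z j ^ (μ i + 2 * ((N : ℤ) - 1 - (i : ℕ))) +
        z j ^ (-(μ i + 2 * ((N : ℤ) - 1 - (i : ℕ))))) /
   Matrix.det (Matrix.of fun i j : Fin N =>
      z j ^ (2 * ((N : ℤ) - 1 - (i : ℕ))) + z j ^ (-(2 * ((N : ℤ) - 1 - (i : ℕ))))))

/-- The matrix `Ā_λ` of the bialternant formula for the intermediate symplectic character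
`sp^{(k, N-k)}`, in "doubled" form: `z i` represents `x_i^{1/2}`, `μ i` represents `2·λ_i`. -/
def interMatD {N : ℕ} (k : ℕ) (z : Fin N → F) (μ : Fin N → ℤ) : Matrix (Fin N) (Fin N) F :=
  Matrix.of fun i j : Fin N =>
    if (j : ℕ) < k then
      z j ^ (μ i + 2 * ((k : ℤ) - (i : ℕ))) /
          ∏ l ∈ Finset.univ.filter (fun l : Fin N => k ≤ (l : ℕ)), (1 - (z j ^ 2)⁻¹ * z l ^ 2) -
        z j ^ (-(μ i + 2 * ((k : ℤ) - (i : ℕ)))) /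
          ∏ l ∈ Finset.univ.filter (fun l : Fin N => k ≤ (l : ℕ)), (1 - z j ^ 2 * z l ^ 2)
    else z j ^ (μ i + 2 * ((N : ℤ) - 1 - (i : ℕ)))

/-- Intermediate symplectic character `sp^{(k, N-k)}_λ(x_1, …, x_k | x_{k+1}, …, x_N)`, in
"doubled" form: `z i` represents `x_i^{1/2}` and `μ i` represents `2·λ_i`. -/
def spInterD {N : ℕ} (k : ℕ) (z : Fin N → F) (μ : Fin N → ℤ) : F :=
  (interMatD k z μ).det / (interMatD k z fun _ => 0).det

/-- The product over `i < j` splits off the factors involving a given index `p`. -/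
lemma prod_Ioi_succAbove {n : ℕ} (f : Fin (n + 1) → Fin (n + 1) → F) (p : Fin (n + 1)) :
    ∏ i, ∏ j ∈ Finset.Ioi i, f i j =
      (∏ i : Fin n, if p.succAbove i < p then f (p.succAbove i) p else f p (p.succAbove i)) *
        ∏ i : Fin n, ∏ j ∈ Finset.Ioi i, f (p.succAbove i) (p.succAbove j) := by
  have key : ∀ {m : ℕ} (g : Fin m → Fin m → F),
      ∏ i, ∏ j ∈ Finset.Ioi i, g i j = ∏ i, ∏ j, if i < j then g i j else 1 := by
    intro m g
    refine Finset.prod_congr rfl fun i _ => ?_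
    rw [← Finset.prod_filter]
    congr 1
    ext j
    simp
  rw [key, key, Fin.prod_univ_succAbove _ p, Fin.prod_univ_succAbove _ p]
  simp only [Fin.prod_univ_succAbove _ p, lt_irrefl, if_false, one_mul,
    Fin.succAbove_lt_succAbove_iff, Finset.prod_mul_distrib]
  rw [← mul_assoc, ← Finset.prod_mul_distrib]
  congr 1
  refine Finset.prod_congr rfl fun i _ => ?_
  rcases lt_or_gt_of_ne (Fin.succAbove_ne p i) with h | h
  · simp [h, h.not_gt]
  · simp [h, h.not_gt]

/-- The Vandermonde product `∏_{i < j} (u_i - u_j)`. -/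
def vdm {n : ℕ} (u : Fin n → F) : F := ∏ i, ∏ j ∈ Finset.Ioi i, (u i - u j)

lemma det_rev_vandermonde {n : ℕ} (u : Fin n → F) :
    det (of fun i j : Fin n => u j ^ ((n : ℤ) - 1 - (i : ℕ))) = vdm u := by
  have h := det_projVandermonde (fun _ : Fin n => (1 : F)) u
  rw [← det_transpose] at h
  rw [vdm]
  simp only [one_mul] at h
  rw [← h]
  congr 1
  ext i j
  simp only [of_apply, transpose_apply, projVandermonde_apply, one_pow, one_mul]
  rw [← zpow_natCast, Fin.val_rev]
  congr 1
  omega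

lemma vdm_ne_zero {n : ℕ} {u : Fin n → F} (hu : Function.Injective u) : vdm u ≠ 0 := by
  refine Finset.prod_ne_zero_iff.2 fun i _ => Finset.prod_ne_zero_iff.2 fun j hj => ?_
  exact sub_ne_zero.2 fun h => (Finset.mem_Ioi.1 hj).ne (hu h)

lemma vdm_succAbove {n : ℕ} (u : Fin (n + 1) → F) (p : Fin (n + 1)) :
    vdm u = (-1) ^ (p : ℕ) * (∏ i, (u p - u (p.succAbove i))) *
      vdm (fun i => u (p.succAbove i)) := by
  rw [vdm, prod_Ioi_succAbove _ p, vdm]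
  congr 1
  have h : ∀ i : Fin n, (if p.succAbove i < p then u (p.succAbove i) - u p
      else u p - u (p.succAbove i)) =
      (if i.castSucc < p then -1 else 1) * (u p - u (p.succAbove i)) := by
    intro i
    by_cases hi : i.castSucc < p
    · rw [if_pos hi, if_pos ((Fin.succAbove_lt_iff_castSucc_lt p i).2 hi)]
      ring
    · rw [if_neg hi, if_neg (mt (Fin.succAbove_lt_iff_castSucc_lt p i).1 hi), one_mul]
  rw [Finset.prod_congr rfl fun i _ => h i, Finset.prod_mul_distrib, Finset.prod_ite]
  simp only [Finset.prod_const, one_pow, mul_one]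
  congr 2
  have h2 : (Finset.univ.filter fun i : Fin n => i.castSucc < p).map Fin.castSuccEmb =
      Finset.Iio p := by
    ext j
    simp only [Finset.mem_map, Finset.mem_filter, Finset.mem_univ, true_and, Finset.mem_Iio]
    constructor
    · rintro ⟨i, hi, rfl⟩
      exact hi
    · intro hj
      have : (j : ℕ) < n := by have := p.isLt; have : (j : ℕ) < p := hj; omega
      exact ⟨⟨j, this⟩, hj, rfl⟩
  rw [← Finset.card_map Fin.castSuccEmb, h2, Fin.card_Iio]

open Polynomial in
/-- A partial fraction identity, obtained from Lagrange interpolation at `0, u_1, …, u_n`. -/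
lemma sum_prod_sub_div {n : ℕ} (u w : Fin n → F) (hu : Function.Injective u)
    (h0 : ∀ i, u i ≠ 0) :
    ∑ j, (∏ i, (u j - w i)) / (u j * ∏ i ∈ Finset.univ.erase j, (u j - u i)) =
      1 - ∏ i, (w i * (u i)⁻¹) := by
  set v : Fin (n + 1) → F := Fin.cons 0 u with hv
  have hinj : Function.Injective v := by
    rw [hv, Fin.cons_injective_iff]
    exact ⟨fun ⟨i, hi⟩ => h0 i hi, hu⟩
  set P : F[X] := ∏ i, (X - C (w i)) with hP
  have hmon : P.Monic := monic_prod_of_monic _ _ fun i _ => monic_X_sub_C _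
  have hdeg : P.natDegree = n := by
    rw [hP, natDegree_prod_of_monic _ _ fun i _ => monic_X_sub_C _]
    simp
  have h := Lagrange.coeff_eq_sum (s := Finset.univ) (v := v) (P := P) hinj.injOn (by
    rw [Polynomial.degree_eq_natDegree hmon.ne_zero, hdeg]
    simp only [Finset.card_univ, Fintype.card_fin]
    exact_mod_cast Nat.lt_succ_self n)
  have hlead : P.coeff n = 1 := by
    have := hmon.coeff_natDegree
    rwa [hdeg] at this
  have herase : ∀ j : Fin n, (Finset.univ : Finset (Fin (n + 1))).erase j.succ =
      Finset.cons 0 ((Finset.univ.erase j).map (Fin.succEmb n)) (by simp) := by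
    intro j
    ext i
    refine Fin.cases ?_ (fun i => ?_) i
    · simp [Fin.succ_ne_zero, eq_comm]
    · simp
  have herase0 : (Finset.univ : Finset (Fin (n + 1))).erase 0 =
      Finset.univ.map (Fin.succEmb n) := by
    ext i
    refine Fin.cases ?_ (fun i => ?_) i <;> simp
  simp only [Finset.card_univ, Fintype.card_fin, Nat.add_sub_cancel, Fin.sum_univ_succ,
    herase, herase0, Finset.prod_cons, Finset.prod_map, hv, Fin.cons_zero, Fin.cons_succ,
    Fin.coe_succEmb, hP, eval_prod, eval_sub, eval_X, eval_C, zero_sub, sub_zero] at h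
  rw [eq_sub_iff_add_eq, ← hlead, hP, h, add_comm]
  congr 1
  rw [← Finset.prod_div_distrib]
  refine Finset.prod_congr rfl fun i _ => ?_
  rw [neg_div_neg_eq, div_eq_mul_inv]

/-- The conditions under which no denominator of the bialternant formulas vanishes. -/
structure IsGeneric {n : ℕ} (u : Fin n → F) : Prop where
  ne_zero : ∀ i, u i ≠ 0
  injective : Function.Injective u
  mul_ne_one : ∀ i j, u i * u j ≠ 1

/-- Inverts the coordinates of `u` selected by the value `false` of `ε`. -/
def invIf {n : ℕ} (ε : Fin n → Bool) (u : Fin n → F) (i : Fin n) : F :=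
  if ε i then u i else (u i)⁻¹

/-- The sign attached to an inverted variable. -/
def boolSign (F : Type*) [Field F] (b : Bool) : F := if b then 1 else -1

lemma boolSign_mul_self (b : Bool) : boolSign F b * boolSign F b = 1 := by
  cases b <;> simp [boolSign]

namespace IsGeneric

variable {n : ℕ}

lemma invIf {u : Fin n → F} (hu : IsGeneric u) (ε : Fin n → Bool) :
    IsGeneric (invIf ε u) where
  ne_zero i := by
    unfold _root_.invIf
    split_ifs
    · exact hu.ne_zero i
    · exact inv_ne_zero (hu.ne_zero i)
  injective i j h := by
    unfold _root_.invIf at h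
    split_ifs at h
    · exact hu.injective h
    · exact absurd (by rw [h, inv_mul_cancel₀ (hu.ne_zero j)]) (hu.mul_ne_one i j)
    · exact absurd (by rw [← h, inv_mul_cancel₀ (hu.ne_zero i)]) (hu.mul_ne_one j i)
    · exact hu.injective (inv_injective h)
  mul_ne_one i j h := by
    have hi := hu.ne_zero i
    have hj := hu.ne_zero j
    unfold _root_.invIf at h
    split_ifs at h with h1 h2 h2
    · exact hu.mul_ne_one i j h
    · rw [mul_inv_eq_one₀ hj] at h
      rw [hu.injective h] at h1
      exact h2 h1
    · rw [inv_mul_eq_one₀ hi] at h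
      rw [hu.injective h] at h1
      exact h1 h2
    · rw [← mul_inv, inv_eq_one] at h
      exact hu.mul_ne_one i j h

lemma succAbove {u : Fin (n + 1) → F} (hu : IsGeneric u) (p : Fin (n + 1)) :
    IsGeneric fun i => u (p.succAbove i) where
  ne_zero _ := hu.ne_zero _
  injective := hu.injective.comp Fin.succAbove_right_injective
  mul_ne_one _ _ := hu.mul_ne_one _ _

lemma one_sub_inv_ne_zero {u : Fin n → F} (hu : IsGeneric u) (i j : Fin n) :
    1 - (u i)⁻¹ * (u j)⁻¹ ≠ 0 := by
  rw [← mul_inv, sub_ne_zero, ne_comm, Ne, inv_eq_one]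
  exact hu.mul_ne_one i j

end IsGeneric

/-- The denominator of the Weyl character formula of type `C` that does not come from `GL`. -/
def weylDenom {n : ℕ} (v : Fin n → F) : F :=
  (∏ i, (1 - (v i)⁻¹ * (v i)⁻¹)) * ∏ i, ∏ j ∈ Finset.Ioi i, (1 - (v i)⁻¹ * (v j)⁻¹)

lemma weylDenom_ne_zero {n : ℕ} {v : Fin n → F} (hv : IsGeneric v) : weylDenom v ≠ 0 :=
  mul_ne_zero (Finset.prod_ne_zero_iff.2 fun i _ => hv.one_sub_inv_ne_zero i i)
    (Finset.prod_ne_zero_iff.2 fun i _ => Finset.prod_ne_zero_iff.2 fun j _ =>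
      hv.one_sub_inv_ne_zero i j)

lemma weylDenom_succAbove {n : ℕ} (v : Fin (n + 1) → F) (p : Fin (n + 1)) :
    weylDenom v =
      (∏ i, (1 - (v i)⁻¹ * (v p)⁻¹)) * weylDenom fun i => v (p.succAbove i) := by
  rw [weylDenom, weylDenom, prod_Ioi_succAbove _ p, Fin.prod_univ_succAbove _ p,
    Fin.prod_univ_succAbove (fun i => 1 - (v i)⁻¹ * (v p)⁻¹) p]
  simp only [mul_comm (v p)⁻¹ (v (p.succAbove _))⁻¹, ite_self]
  ring

/-- The Weyl-type sum over sign changes which computes `(u_1 ⋯ u_n)^e sp_{(e^n)}(u)`. -/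
def weylSum {n : ℕ} (u : Fin n → F) (e : ℤ) : F :=
  ∑ ε : Fin n → Bool, (∏ i, (u i * invIf ε u i) ^ e) * (weylDenom (invIf ε u))⁻¹

lemma vdm_mul_weylSum_sub {n : ℕ} {u : Fin (n + 1) → F} (hu : IsGeneric u) (e : ℤ) :
    vdm u * (weylSum u e - weylSum u (e - 1)) =
      ∑ j : Fin (n + 1), (-1) ^ (j : ℕ) * u j ^ (2 * e + n) *
        (vdm (fun i => u (j.succAbove i)) * weylSum (fun i => u (j.succAbove i)) e) := by
  have hstep : ∀ ε : Fin (n + 1) → Bool,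
      (∏ i, (u i * invIf ε u i) ^ e) * (weylDenom (invIf ε u))⁻¹ -
        (∏ i, (u i * invIf ε u i) ^ (e - 1)) * (weylDenom (invIf ε u))⁻¹ =
      ∑ j, (∏ i, (u i * invIf ε u i) ^ e) * (weylDenom (invIf ε u))⁻¹ *
        ((∏ i, (u j - (invIf ε u i)⁻¹)) /
          (u j * ∏ i ∈ Finset.univ.erase j, (u j - u i))) := by
    intro ε
    rw [← Finset.mul_sum, sum_prod_sub_div u _ hu.injective hu.ne_zero]
    have : ∏ i, (u i * invIf ε u i) ^ (e - 1) =
        (∏ i, (u i * invIf ε u i) ^ e) * ∏ i, ((invIf ε u i)⁻¹ * (u i)⁻¹) := by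
      rw [← Finset.prod_mul_distrib]
      refine Finset.prod_congr rfl fun i _ => ?_
      rw [zpow_sub_one₀ (mul_ne_zero (hu.ne_zero i) ((hu.invIf ε).ne_zero i)), mul_inv,
        mul_comm (u i)⁻¹]
    rw [this]
    ring
  rw [weylSum, weylSum, ← Finset.sum_sub_distrib, Finset.sum_congr rfl fun ε _ => hstep ε,
    Finset.sum_comm, Finset.mul_sum]
  refine Finset.sum_congr rfl fun j _ => ?_
  rw [← (Fin.insertNthEquiv (fun _ => Bool) j).sum_comp, Fintype.sum_prod_type, Fintype.sum_bool,
    weylSum, Finset.mul_sum, Finset.mul_sum]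
  have hfalse : ∀ ε : Fin n → Bool,
      ∏ i, (u j - (invIf (Fin.insertNthEquiv (fun _ => Bool) j (false, ε)) u i)⁻¹) = 0 := by
    intro ε
    refine Finset.prod_eq_zero (Finset.mem_univ j) ?_
    simp [invIf, Fin.insertNthEquiv]
  simp only [hfalse, zero_div, mul_zero, Finset.sum_const_zero, add_zero]
  rw [Finset.mul_sum]
  refine Finset.sum_congr rfl fun ε _ => ?_
  set v := invIf (Fin.insertNthEquiv (fun _ => Bool) j (true, ε)) u with hv
  have hgen : IsGeneric v := hu.invIf _
  have hvj : v j = u j := by simp [hv, invIf, Fin.insertNthEquiv]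
  have hvs : (fun i => v (j.succAbove i)) = invIf ε fun i => u (j.succAbove i) := by
    ext i
    simp [hv, invIf, Fin.insertNthEquiv]
  have hvs' : ∀ i, v (j.succAbove i) = invIf ε (fun i => u (j.succAbove i)) i := congrFun hvs
  have hw := weylDenom_ne_zero (hgen.succAbove j)
  have hu0 := hu.ne_zero j
  have hp : ∏ i, (u j - (v i)⁻¹) = u j ^ (n + 1) * ∏ i, (1 - (v i)⁻¹ * (v j)⁻¹) := by
    rw [← Fin.prod_const, ← Finset.prod_mul_distrib]
    refine Finset.prod_congr rfl fun i _ => ?_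
    rw [hvj, mul_sub, mul_one, mul_left_comm, mul_inv_cancel₀ hu0, mul_one]
  have hp0 : ∏ i, (1 - (v i)⁻¹ * (v j)⁻¹) ≠ 0 :=
    Finset.prod_ne_zero_iff.2 fun i _ => hgen.one_sub_inv_ne_zero i j
  have herase : ∏ i ∈ Finset.univ.erase j, (u j - u i) = ∏ i, (u j - u (j.succAbove i)) := by
    rw [Fin.univ_succAbove n j, Finset.cons_eq_insert, Finset.erase_insert (by simp),
      Finset.prod_map]
    rfl
  have hq0 : ∏ i, (u j - u (j.succAbove i)) ≠ 0 :=
    Finset.prod_ne_zero_iff.2 fun i _ =>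
      sub_ne_zero.2 fun h => Fin.succAbove_ne j i (hu.injective h).symm
  have hpow : u j ^ (2 * e + n) = (u j * u j) ^ e * u j ^ n := by
    rw [zpow_add₀ hu0, zpow_natCast, two_mul, zpow_add₀ hu0, mul_zpow]
  rw [weylDenom_succAbove v j, hvs, hp, herase, vdm_succAbove u j, Fin.prod_univ_succAbove _ j, hvj,
    hpow]
  simp only [hvs']
  rw [hvs] at hw
  rw [hvj] at hp0
  generalize ∏ i, (1 - (v i)⁻¹ * (u j)⁻¹) = A at hp0 ⊢
  field_simp
  ring

lemma det_add_eq_sum_bool {n : ℕ} (f : Bool → Fin n → Fin n → F) :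
    det (of fun i j => f true i j + f false i j) =
      ∑ ε : Fin n → Bool, det (of fun i j => f (ε j) i j) := by
  rw [← det_transpose]
  have h := (detRowAlternating (n := Fin n) (R := F)).toMultilinearMap.map_sum
    (fun (j : Fin n) (b : Bool) (i : Fin n) => f b i j)
  convert h using 1
  · congr 1
    ext j i
    simp
  · refine Finset.sum_congr rfl fun ε _ => ?_
    rw [← det_transpose]
    rfl

lemma det_signed_alternant {n : ℕ} (α : Bool → Fin n → F) (u : Fin n → F) (p : Fin n → ℤ) :
    det (of fun i j => α true j * u j ^ p i + α false j * u j ^ (-p i)) =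
      ∑ ε : Fin n → Bool, (∏ j, α (ε j) j) * det (of fun i j => invIf ε u j ^ p i) := by
  have h := det_add_eq_sum_bool fun b i j => α b j * if b then u j ^ p i else u j ^ (-p i)
  simp only [if_true, Bool.false_eq_true, if_false] at h
  rw [h]
  refine Finset.sum_congr rfl fun ε _ => ?_
  rw [← det_mul_row]
  congr 1
  ext i j
  simp only [of_apply, invIf]
  split_ifs
  · rfl
  · rw [_root_.inv_zpow, _root_.zpow_neg]

lemma det_shifted_vandermonde {n : ℕ} {v : Fin n → F} (hv : ∀ i, v i ≠ 0) (c : ℤ) :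
    det (of fun i j : Fin n => v j ^ (c + ((n : ℤ) - 1 - (i : ℕ)))) = (∏ j, v j ^ c) * vdm v := by
  rw [← det_rev_vandermonde, ← det_mul_row]
  congr 1
  ext i j
  rw [of_apply, of_apply, of_apply, zpow_add₀ (hv j)]

/-- The numerator of the symplectic character of the rectangle `(e^n)`. -/
def spDet {n : ℕ} (u : Fin n → F) (e : ℤ) : F :=
  det (of fun i j : Fin n => u j ^ (e + (n - (i : ℕ))) - u j ^ (-(e + (n - (i : ℕ)))))

lemma prod_boolSign_mul_vdm {n : ℕ} {u : Fin n → F} (hu : IsGeneric u) (ε : Fin n → Bool) :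
    (∏ i, invIf ε u i) * vdm (invIf ε u) * weylDenom (invIf ε u) =
      (∏ i, boolSign F (ε i)) * ((∏ i, (u i - (u i)⁻¹)) *
        ∏ i, ∏ j ∈ Finset.Ioi i, ((u i + (u i)⁻¹) - (u j + (u j)⁻¹))) := by
  have h1 : (∏ i, invIf ε u i) * ∏ i, (1 - (invIf ε u i)⁻¹ * (invIf ε u i)⁻¹) =
      (∏ i, boolSign F (ε i)) * ∏ i, (u i - (u i)⁻¹) := by
    rw [← Finset.prod_mul_distrib, ← Finset.prod_mul_distrib]
    refine Finset.prod_congr rfl fun i _ => ?_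
    have := hu.ne_zero i
    cases h : ε i <;> simp only [invIf, boolSign, h] <;> simp <;> field_simp
  have hy : ∀ i, invIf ε u i + (invIf ε u i)⁻¹ = u i + (u i)⁻¹ := by
    intro i
    cases h : ε i <;> simp [invIf, h, add_comm]
  have h2 : vdm (invIf ε u) *
      ∏ i, ∏ j ∈ Finset.Ioi i, (1 - (invIf ε u i)⁻¹ * (invIf ε u j)⁻¹) =
      ∏ i, ∏ j ∈ Finset.Ioi i, ((u i + (u i)⁻¹) - (u j + (u j)⁻¹)) := by
    rw [vdm, ← Finset.prod_mul_distrib]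
    refine Finset.prod_congr rfl fun i _ => ?_
    rw [← Finset.prod_mul_distrib]
    refine Finset.prod_congr rfl fun j _ => ?_
    rw [← hy, ← hy]
    have hi := (hu.invIf ε).ne_zero i
    have hj := (hu.invIf ε).ne_zero j
    field_simp
    ring
  rw [weylDenom, ← h2, ← mul_assoc (∏ i, boolSign F (ε i)), ← h1]
  ring

/-- The Weyl denominator of type `C`. -/
def spDenom {n : ℕ} (u : Fin n → F) : F :=
  (∏ i, (u i - (u i)⁻¹)) * ∏ i, ∏ j ∈ Finset.Ioi i, ((u i + (u i)⁻¹) - (u j + (u j)⁻¹))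

lemma spDenom_ne_zero {n : ℕ} {u : Fin n → F} (hu : IsGeneric u) : spDenom u ≠ 0 := by
  have h := prod_boolSign_mul_vdm hu fun _ => true
  have h1 : invIf (fun _ => true) u = u := by ext; simp [invIf]
  rw [h1, ← spDenom] at h
  simp only [boolSign, if_true, Finset.prod_const_one, one_mul] at h
  rw [← h]
  exact mul_ne_zero (mul_ne_zero (Finset.prod_ne_zero_iff.2 fun i _ => hu.ne_zero i)
    (vdm_ne_zero hu.injective)) (weylDenom_ne_zero hu)

lemma prod_zpow_mul_spDet {n : ℕ} {u : Fin n → F} (hu : IsGeneric u) (e : ℤ) :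
    (∏ i, u i ^ e) * spDet u e = spDenom u * weylSum u e := by
  have h := det_signed_alternant (fun b _ => boolSign F b) u fun i => e + ((n : ℤ) - (i : ℕ))
  have h' : spDet u e = det (of fun i j : Fin n =>
      boolSign F true * u j ^ (e + ((n : ℤ) - (i : ℕ))) +
        boolSign F false * u j ^ (-(e + ((n : ℤ) - (i : ℕ))))) := by
    rw [spDet]
    congr 1
    ext i j
    simp [boolSign, sub_eq_add_neg]
  rw [h', h, weylSum, Finset.mul_sum, Finset.mul_sum]
  refine Finset.sum_congr rfl fun ε _ => ?_
  have hg := hu.invIf ε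
  have hs : det (of fun i j => invIf ε u j ^ (e + ((n : ℤ) - (i : ℕ)))) =
      (∏ j, invIf ε u j ^ e) * ((∏ j, invIf ε u j) * vdm (invIf ε u)) := by
    rw [← mul_assoc, ← Finset.prod_mul_distrib]
    simp only [← zpow_add_one₀ (hg.ne_zero _)]
    rw [← det_shifted_vandermonde hg.ne_zero]
    congr 1
    ext i j
    simp only [of_apply]
    congr 1
    ring
  have hw := weylDenom_ne_zero hg
  have hp := prod_boolSign_mul_vdm hu ε
  rw [← spDenom] at hp
  rw [← eq_div_iff hw] at hp
  rw [hs, hp]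
  simp only [mul_zpow, Finset.prod_mul_distrib]
  have hsq : (∏ i, boolSign F (ε i)) * ∏ i, boolSign F (ε i) = 1 := by
    rw [← Finset.prod_mul_distrib]
    simp [boolSign_mul_self]
  linear_combination (∏ i, u i ^ e) * (∏ j, invIf ε u j ^ e) * spDenom u *
    (weylDenom (invIf ε u))⁻¹ * hsq

lemma spDet_neg_one {n : ℕ} (u : Fin (n + 1) → F) : spDet u (-1) = 0 := by
  refine det_eq_zero_of_row_eq_zero (Fin.last n) fun j => ?_
  simp


/-- Partitions with at most `n` parts, all smaller than `B`. -/
def boxPart (n B : ℕ) : Finset (Fin n → ℕ) :=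
  (Fintype.piFinset fun _ => Finset.range B).filter Antitone

lemma mem_boxPart {n B : ℕ} {l : Fin n → ℕ} : l ∈ boxPart n B ↔ (∀ i, l i < B) ∧ Antitone l := by
  simp [boxPart]

/-- The sum over the partitions `l` in a box of the alternants of the even partitions `2 * l`. -/
def evenAltSum {n : ℕ} (u : Fin n → F) (B : ℕ) : F :=
  ∑ l ∈ boxPart n B, det (of fun i j => u j ^ (2 * (l i : ℤ) + ((n : ℤ) - 1 - (i : ℕ))))

lemma evenAltSum_succ {n : ℕ} (u : Fin (n + 1) → F) (B : ℕ) :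
    evenAltSum u (B + 1) = evenAltSum u B +
      ∑ j : Fin (n + 1), (-1) ^ (j : ℕ) * u j ^ (2 * (B : ℤ) + n) *
        evenAltSum (fun i => u (j.succAbove i)) (B + 1) := by
  have hsmall : (boxPart (n + 1) (B + 1)).filter (fun l => ¬ l 0 = B) = boxPart (n + 1) B := by
    ext l
    simp only [Finset.mem_filter, mem_boxPart]
    constructor
    · rintro ⟨⟨h1, h2⟩, h3⟩
      have := h1 0
      exact ⟨fun i => lt_of_le_of_lt (h2 (Fin.zero_le i)) (by omega), h2⟩
    · rintro ⟨h1, h2⟩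
      exact ⟨⟨fun i => (h1 i).trans (Nat.lt_succ_self B), h2⟩, (h1 0).ne⟩
  have hlarge : ∀ g : (Fin (n + 1) → ℕ) → F,
      ∑ l ∈ (boxPart (n + 1) (B + 1)).filter (fun l => l 0 = B), g l =
        ∑ l ∈ boxPart n (B + 1), g (Fin.cons B l) := by
    intro g
    refine Finset.sum_nbij' Fin.tail (fun l => Fin.cons B l) ?_ ?_ ?_ ?_ ?_
    · intro l hl
      simp only [Finset.mem_filter, mem_boxPart] at hl ⊢
      exact ⟨fun i => hl.1.1 _, fun i j hij => hl.1.2 (Fin.succ_le_succ_iff.2 hij)⟩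
    · intro l hl
      simp only [Finset.mem_filter, mem_boxPart] at hl ⊢
      refine ⟨⟨fun i => ?_, fun i j hij => ?_⟩, Fin.cons_zero _ _⟩
      · refine Fin.cases ?_ (fun i => ?_) i
        · simp
        · simpa using hl.1 i
      · induction i using Fin.cases with
        | zero =>
          induction j using Fin.cases with
          | zero => exact le_rfl
          | succ j => simpa using Nat.lt_succ_iff.1 (hl.1 j)
        | succ i =>
          induction j using Fin.cases with
          | zero => simp at hij
          | succ j => simpa using hl.2 (Fin.succ_le_succ_iff.1 hij)
    · intro l hl
      rw [← (Finset.mem_filter.1 hl).2]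
      exact Fin.cons_self_tail l
    · intro l _
      exact Fin.tail_cons _ _
    · intro l hl
      rw [← (Finset.mem_filter.1 hl).2, Fin.cons_self_tail]
  rw [evenAltSum, ← Finset.sum_filter_add_sum_filter_not _ (fun l => l 0 = B), hsmall, hlarge,
    add_comm, evenAltSum]
  congr 1
  simp only [evenAltSum, Finset.mul_sum]
  rw [Finset.sum_comm]
  refine Finset.sum_congr rfl fun l _ => ?_
  rw [det_succ_row_zero]
  refine Finset.sum_congr rfl fun j _ => ?_
  congr 1
  · simp
  · congr 1
    ext i i'
    simp only [submatrix_apply, of_apply, Fin.cons_succ, Fin.val_succ]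
    congr 1
    push_cast
    ring

lemma weylSum_neg_one {n : ℕ} {u : Fin (n + 1) → F} (hu : IsGeneric u) : weylSum u (-1) = 0 := by
  have h := prod_zpow_mul_spDet hu (-1)
  rw [spDet_neg_one, mul_zero] at h
  exact (mul_eq_zero.1 h.symm).resolve_left (spDenom_ne_zero hu)

lemma evenAltSum_eq_weylSum {n : ℕ} : ∀ {u : Fin n → F}, IsGeneric u → ∀ B : ℕ,
    evenAltSum u B = vdm u * weylSum u ((B : ℤ) - 1) := by
  induction n with
  | zero =>
    intro u _ B
    have : boxPart 0 B = Finset.univ := by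
      refine Finset.eq_univ_of_forall fun l => ?_
      simp [mem_boxPart, Antitone]
    simp [evenAltSum, this, vdm, weylSum, weylDenom]
  | succ n ih =>
    intro u hu B
    induction B with
    | zero =>
      have : boxPart (n + 1) 0 = ∅ := by
        ext l
        simp [mem_boxPart]
      simp [evenAltSum, this, weylSum_neg_one hu]
    | succ B ihB =>
      have h := vdm_mul_weylSum_sub hu (B : ℤ)
      rw [evenAltSum_succ, ihB, ← eq_sub_iff_add_eq']
      push_cast
      rw [add_sub_cancel_right, ← mul_sub, h]
      refine Finset.sum_congr rfl fun j _ => ?_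
      rw [ih (hu.succAbove j)]
      push_cast
      rw [add_sub_cancel_right]

lemma weylSum_zero {n : ℕ} {u : Fin n → F} (hu : IsGeneric u) : weylSum u 0 = 1 := by
  have h := evenAltSum_eq_weylSum hu 1
  have h1 : boxPart n 1 = {fun _ => 0} := by
    ext l
    simp only [mem_boxPart, Nat.lt_one_iff, Finset.mem_singleton]
    constructor
    · exact fun h => funext h.1
    · rintro rfl
      exact ⟨fun _ => rfl, fun _ _ _ => le_rfl⟩
  simp only [evenAltSum, h1, Finset.sum_singleton, Nat.cast_zero, mul_zero, zero_add,
    det_rev_vandermonde, Nat.cast_one, sub_self] at h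
  exact (mul_eq_left₀ (vdm_ne_zero hu.injective)).1 h.symm

lemma spDet_zero {n : ℕ} {u : Fin n → F} (hu : IsGeneric u) : spDet u 0 = spDenom u := by
  simpa [weylSum_zero hu] using prod_zpow_mul_spDet hu 0

lemma spDet_invIf {n : ℕ} (ε : Fin n → Bool) (u : Fin n → F) (e : ℤ) :
    spDet (invIf ε u) e = (∏ i, boolSign F (ε i)) * spDet u e := by
  rw [spDet, spDet, ← det_mul_row]
  congr 1
  ext i j
  simp only [of_apply]
  cases h : ε j <;> simp [invIf, boolSign, h]

/-- **Bounded Littlewood identity** for even partitions, in bialternant form. -/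
lemma evenAltSum_eq {n : ℕ} {u : Fin n → F} (hu : IsGeneric u) (ε : Fin n → Bool) (M : ℕ) :
    evenAltSum (invIf ε u) (M + 1) = spDet u M / spDet u 0 *
      det (of fun i j : Fin n => invIf ε u j ^ ((M : ℤ) + ((n : ℤ) - 1 - (i : ℕ)))) := by
  have hg := hu.invIf ε
  have h0 := spDenom_ne_zero hg
  have hs : spDet u M / spDet u 0 = spDet (invIf ε u) M / spDet (invIf ε u) 0 := by
    rw [spDet_invIf, spDet_invIf, mul_div_mul_left]
    refine Finset.prod_ne_zero_iff.2 fun i _ => ?_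
    cases h : ε i <;> simp [boolSign]
  have h := prod_zpow_mul_spDet hg (M : ℤ)
  rw [evenAltSum_eq_weylSum hg, hs, spDet_zero hg, det_shifted_vandermonde hg.ne_zero]
  push_cast
  rw [add_sub_cancel_right]
  field_simp
  linear_combination (-vdm (invIf ε u)) * h

lemma sum_det_signed_alternant {n : ℕ} {u : Fin n → F} (hu : IsGeneric u) (α : Bool → Fin n → F)
    (M : ℕ) :
    ∑ l ∈ boxPart n (M + 1), det (of fun i j =>
        α true j * u j ^ (2 * (l i : ℤ) + ((n : ℤ) - 1 - (i : ℕ))) +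
          α false j * u j ^ (-(2 * (l i : ℤ) + ((n : ℤ) - 1 - (i : ℕ))))) =
      spDet u M / spDet u 0 * det (of fun i j : Fin n =>
        α true j * u j ^ ((M : ℤ) + ((n : ℤ) - 1 - (i : ℕ))) +
          α false j * u j ^ (-((M : ℤ) + ((n : ℤ) - 1 - (i : ℕ))))) := by
  simp only [det_signed_alternant α u]
  rw [Finset.sum_comm, Finset.mul_sum]
  refine Finset.sum_congr rfl fun ε _ => ?_
  rw [← Finset.mul_sum]
  have h := evenAltSum_eq hu ε M
  rw [evenAltSum] at h
  rw [h]
  ring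

lemma isGeneric_gen_sq (n : ℕ) : IsGeneric fun i => gen n i ^ 2 := by
  have hinj := IsFractionRing.injective (MvPolynomial (Fin n) ℚ) (FF n)
  refine ⟨fun i => pow_ne_zero 2 ?_, fun i j h => ?_, fun i j h => ?_⟩
  · intro h
    exact MvPolynomial.X_ne_zero i (hinj (by rw [map_zero]; exact h))
  · have h' : (MvPolynomial.X i : MvPolynomial (Fin n) ℚ) ^ 2 = MvPolynomial.X j ^ 2 :=
      hinj (by rw [map_pow, map_pow]; exact h)
    have h2 := congrArg (MvPolynomial.eval (Pi.single i 1)) h'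
    by_contra hij
    simp [Pi.single_eq_of_ne' hij] at h2
  · have h' : (MvPolynomial.X i : MvPolynomial (Fin n) ℚ) ^ 2 * MvPolynomial.X j ^ 2 = 1 :=
      hinj (by rw [map_mul, map_pow, map_pow, map_one]; exact h)
    have h2 := congrArg (MvPolynomial.eval 0) h'
    simp at h2

lemma spD_const_eq {n : ℕ} (z : Fin n → F) (M : ℕ) :
    spD z (fun _ => 2 * (M : ℤ)) = spDet (fun i => z i ^ 2) M / spDet (fun i => z i ^ 2) 0 := by
  have h : ∀ e x : ℤ, ∀ j, (z j ^ 2) ^ (e + x) - (z j ^ 2) ^ (-(e + x)) =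
      z j ^ (2 * e + 2 * x) - z j ^ (-(2 * e + 2 * x)) := by
    intro e x j
    rw [← zpow_natCast, ← _root_.zpow_mul, ← _root_.zpow_mul]
    congr 2 <;> push_cast <;> ring
  simp only [spD, spDet, h]
  simp only [mul_zero, zero_add]

/-- The coefficients with which `x_j ^ p` and `x_j ^ (-p)` enter the matrix `interMatD`. -/
def interCoeff {n : ℕ} (k : ℕ) (z : Fin n → F) (a : ℤ) (b : Bool) (j : Fin n) : F :=
  if (j : ℕ) < k then
    if b then z j ^ (a + 2) / ∏ l ∈ Finset.univ.filter (fun l : Fin n => k ≤ (l : ℕ)),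
        (z j ^ 2 - z l ^ 2)
    else -(z j ^ (-(a + 2)) / ∏ l ∈ Finset.univ.filter (fun l : Fin n => k ≤ (l : ℕ)),
        ((z j ^ 2)⁻¹ - z l ^ 2))
  else if b then z j ^ a else 0

lemma card_filter_le {n k : ℕ} (hk : k ≤ n) :
    (Finset.univ.filter fun l : Fin n => k ≤ (l : ℕ)).card = n - k := by
  have h := Finset.card_filter_add_card_filter_not (s := (Finset.univ : Finset (Fin n)))
    (fun l : Fin n => (l : ℕ) < k)
  rw [Fin.card_filter_val_lt, Finset.card_univ, Fintype.card_fin] at h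
  simp only [not_lt] at h
  omega

lemma interMatD_eq {n k : ℕ} (hk : k ≤ n) {z : Fin n → F} (hz : ∀ i, z i ≠ 0) (a : ℤ)
    (w : Fin n → ℤ) :
    interMatD k z (fun i => 2 * w i + a) = of fun i j =>
      interCoeff k z a true j * (z j ^ 2) ^ (w i + ((n : ℤ) - 1 - (i : ℕ))) +
        interCoeff k z a false j * (z j ^ 2) ^ (-(w i + ((n : ℤ) - 1 - (i : ℕ)))) := by
  have hprod : ∀ t : F, t ≠ 0 →
      ∏ l ∈ Finset.univ.filter (fun l : Fin n => k ≤ (l : ℕ)), (1 - t⁻¹ * z l ^ 2) =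
        t ^ (-((n : ℤ) - k)) *
          ∏ l ∈ Finset.univ.filter (fun l : Fin n => k ≤ (l : ℕ)), (t - z l ^ 2) := by
    intro t ht
    have : t ^ (-((n : ℤ) - k)) =
        ∏ _l ∈ Finset.univ.filter (fun l : Fin n => k ≤ (l : ℕ)), t⁻¹ := by
      rw [Finset.prod_const, card_filter_le hk, ← Nat.cast_sub hk, _root_.zpow_neg, zpow_natCast,
        inv_pow]
    rw [this, ← Finset.prod_mul_distrib]
    refine Finset.prod_congr rfl fun l _ => ?_
    rw [mul_sub, inv_mul_cancel₀ ht]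
  ext i j
  have h0 := hz j
  have hsq : ∀ e : ℤ, (z j ^ 2) ^ e = z j ^ (2 * e) := by
    intro e
    rw [← zpow_natCast, ← _root_.zpow_mul]
    rfl
  simp only [interMatD, interCoeff, of_apply, if_true, Bool.false_eq_true, if_false]
  split_ifs
  · have h2 := hprod ((z j ^ 2)⁻¹) (inv_ne_zero (pow_ne_zero 2 h0))
    rw [inv_inv] at h2
    rw [hprod _ (pow_ne_zero 2 h0), h2, _root_.inv_zpow, ← _root_.zpow_neg, hsq, hsq, hsq, hsq,
      sub_eq_add_neg]
    congr 1
    · rw [div_mul_eq_div_div, ← zpow_sub₀ h0, div_mul_eq_mul_div, ← zpow_add₀ h0]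
      congr 2
      ring
    · rw [div_mul_eq_div_div, ← zpow_sub₀ h0, neg_mul, div_mul_eq_mul_div, ← zpow_add₀ h0]
      congr 3
      ring
  · rw [zero_mul, add_zero, hsq, ← zpow_add₀ h0]
    congr 1
    ring

lemma sum_even_filter_eq_sum_boxPart (n M : ℕ) (g : (Fin n → ℤ) → F) :
    ∑ lam ∈ Finset.univ.filter
        (fun lam : Fin n → Fin (2 * M + 1) =>
          (Antitone fun i => (lam i : ℕ)) ∧ ∀ i, Even (lam i : ℕ)),
      g (fun i => ((lam i : ℕ) : ℤ)) = ∑ l ∈ boxPart n (M + 1), g (fun i => 2 * (l i : ℤ)) := by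
  have hval : ∀ l ∈ boxPart n (M + 1), ∀ i, ((Fin.ofNat (2 * M + 1) (2 * l i) : Fin _) : ℕ) =
      2 * l i := by
    intro l hl i
    have := (mem_boxPart.1 hl).1 i
    exact Nat.mod_eq_of_lt (by omega)
  refine Finset.sum_nbij' (fun lam i => (lam i : ℕ) / 2)
    (fun l i => Fin.ofNat (2 * M + 1) (2 * l i)) ?_ ?_ ?_ ?_ ?_
  · intro lam hlam
    have h := (Finset.mem_filter.1 hlam).2
    refine mem_boxPart.2 ⟨fun i => ?_, fun i j hij => Nat.div_le_div_right (h.1 hij)⟩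
    have := (lam i).isLt
    show (lam i : ℕ) / 2 < M + 1
    omega
  · intro l hl
    refine Finset.mem_filter.2 ⟨Finset.mem_univ _, ?_⟩
    simp only [hval l hl]
    exact ⟨fun i j hij => Nat.mul_le_mul_left 2 ((mem_boxPart.1 hl).2 hij), fun i =>
      even_two_mul _⟩
  · intro lam hlam
    have h := (Finset.mem_filter.1 hlam).2
    ext i
    have := (lam i).isLt
    simp only [Nat.two_mul_div_two_of_even (h.2 i)]
    exact Nat.mod_eq_of_lt this
  · intro l hl
    ext i
    simp only [hval l hl]
    omega
  · intro lam hlam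
    have h := (Finset.mem_filter.1 hlam).2
    congr 1
    ext i
    have := Nat.two_mul_div_two_of_even (h.2 i)
    exact_mod_cast this.symm

section Factorization

open Polynomial

variable {k r : ℕ}

/-- Monic polynomials of degrees `k + r - 1, …, 0`; those of degree at least `r` vanish
at the last `r` of the points `x`. -/
def rowPoly (x : Fin (k + r) → F) (i : Fin (k + r)) : F[X] :=
  if (i : ℕ) < k then
    X ^ (k - 1 - (i : ℕ)) * ∏ l : Fin r, (X - C (x (Fin.natAdd k l)))
  else X ^ (k + r - 1 - (i : ℕ))

lemma rowPoly_monic (x : Fin (k + r) → F) (i : Fin (k + r)) : (rowPoly x i).Monic := by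
  unfold rowPoly
  split_ifs
  · exact (monic_X_pow _).mul (monic_prod_of_monic _ _ fun _ _ => monic_X_sub_C _)
  · exact monic_X_pow _

lemma natDegree_rowPoly (x : Fin (k + r) → F) (i : Fin (k + r)) :
    (rowPoly x i).natDegree = k + r - 1 - (i : ℕ) := by
  unfold rowPoly
  split_ifs
  · rw [(monic_X_pow _).natDegree_mul (monic_prod_of_monic _ _ fun _ _ => monic_X_sub_C _),
      natDegree_X_pow, natDegree_prod_of_monic _ _ fun _ _ => monic_X_sub_C _]
    simp
    omega
  · exact natDegree_X_pow _

/-- The unitriangular matrix of coefficients of the polynomials `rowPoly`. -/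
def rowOp (x : Fin (k + r) → F) : Matrix (Fin (k + r)) (Fin (k + r)) F :=
  of fun i i' => (rowPoly x i).coeff (k + r - 1 - (i' : ℕ))

lemma det_rowOp (x : Fin (k + r) → F) : (rowOp x).det = 1 := by
  rw [det_of_isUpperTriangular]
  · refine Finset.prod_eq_one fun i _ => ?_
    rw [rowOp, of_apply, ← natDegree_rowPoly x i]
    exact rowPoly_monic x i
  · intro i j hij
    have h : (j : ℕ) < i := hij
    show (rowPoly x i).coeff (k + r - 1 - (j : ℕ)) = 0
    refine coeff_eq_zero_of_natDegree_lt ?_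
    rw [natDegree_rowPoly]
    omega

lemma sum_rowOp_mul_pow (x : Fin (k + r) → F) (i : Fin (k + r)) (t : F) :
    ∑ i', rowOp x i i' * t ^ (k + r - 1 - (i' : ℕ)) = (rowPoly x i).eval t := by
  rw [eval_eq_sum_range' (n := k + r) (by rw [natDegree_rowPoly]; omega),
    ← Fin.sum_univ_eq_sum_range fun d => (rowPoly x i).coeff d * t ^ d]
  refine Fintype.sum_equiv Fin.revPerm _ _ fun i' => ?_
  have : ((Fin.revPerm i' : Fin (k + r)) : ℕ) = k + r - 1 - (i' : ℕ) := by
    rw [Fin.revPerm_apply, Fin.val_rev]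
    omega
  rw [rowOp, of_apply, this]

lemma prod_filter_le_eq (g : Fin (k + r) → F) :
    ∏ l ∈ Finset.univ.filter (fun l : Fin (k + r) => k ≤ (l : ℕ)), g l =
      ∏ l : Fin r, g (Fin.natAdd k l) := by
  rw [Finset.prod_filter, Fin.prod_univ_add]
  rw [Finset.prod_eq_one fun i _ => if_neg (by simp), one_mul]
  exact Finset.prod_congr rfl fun l _ => if_pos (by simp)

lemma det_interMatD_const {z : Fin (k + r) → F} (hz : IsGeneric fun i => z i ^ 2) (c : ℤ) :
    (interMatD k z fun _ => c).det =
      det (of fun i j : Fin k => z (Fin.castAdd r j) ^ (c + 2 * ((k : ℤ) - (i : ℕ))) -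
        z (Fin.castAdd r j) ^ (-(c + 2 * ((k : ℤ) - (i : ℕ))))) *
      ((∏ l : Fin r, z (Fin.natAdd k l) ^ c) * vdm fun l : Fin r => z (Fin.natAdd k l) ^ 2) := by
  have hz0 : ∀ i, z i ≠ 0 := fun i h => hz.ne_zero i (by simp [h])
  set x : Fin (k + r) → F := fun i => z i ^ 2 with hx
  have hmat := interMatD_eq (Nat.le_add_right k r) hz0 c fun _ => 0
  simp only [mul_zero, zero_add] at hmat
  have hentry : ∀ i j, (rowOp x * interMatD k z fun _ => c) i j =
      interCoeff k z c true j * (rowPoly x i).eval (x j) +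
        interCoeff k z c false j * (rowPoly x i).eval (x j)⁻¹ := by
    intro i j
    rw [hmat, Matrix.mul_apply, ← sum_rowOp_mul_pow, ← sum_rowOp_mul_pow, Finset.mul_sum,
      Finset.mul_sum, ← Finset.sum_add_distrib]
    refine Finset.sum_congr rfl fun i' _ => ?_
    have hexp : (((k + r : ℕ) : ℤ) - 1 - (i' : ℕ)) = ((k + r - 1 - (i' : ℕ) : ℕ) : ℤ) := by
      omega
    rw [of_apply, hexp, _root_.zpow_neg, zpow_natCast, inv_pow]
    ring
  have hblock : (rowOp x * interMatD k z fun _ => c).submatrix finSumFinEquiv finSumFinEquiv =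
      fromBlocks
        (of fun i j : Fin k => z (Fin.castAdd r j) ^ (c + 2 * ((k : ℤ) - (i : ℕ))) -
          z (Fin.castAdd r j) ^ (-(c + 2 * ((k : ℤ) - (i : ℕ))))) 0
        (of fun (i : Fin r) (j : Fin k) => (rowOp x * interMatD k z fun _ => c)
          (Fin.natAdd k i) (Fin.castAdd r j))
        (of fun i j : Fin r => z (Fin.natAdd k j) ^ c *
          (z (Fin.natAdd k j) ^ 2) ^ ((r : ℤ) - 1 - (i : ℕ))) := by
    ext i j
    rcases i with i | i <;> rcases j with j | j
    · simp only [submatrix_apply, finSumFinEquiv_apply_left, fromBlocks_apply₁₁, of_apply, hentry,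
        interCoeff, prod_filter_le_eq, rowPoly, Fin.val_castAdd, Fin.is_lt, if_true,
        Bool.false_eq_true, if_false, eval_mul, eval_pow, eval_X, eval_prod, eval_sub, eval_C]
      simp only [hx]
      have h1 : ∏ l : Fin r, (z (Fin.castAdd r j) ^ 2 - z (Fin.natAdd k l) ^ 2) ≠ 0 := by
        refine Finset.prod_ne_zero_iff.2 fun l _ => sub_ne_zero.2 fun h => ?_
        have := congrArg Fin.val (hz.injective h)
        simp at this
        omega
      have h2 : ∏ l : Fin r, ((z (Fin.castAdd r j) ^ 2)⁻¹ - z (Fin.natAdd k l) ^ 2) ≠ 0 := by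
        refine Finset.prod_ne_zero_iff.2 fun l _ => sub_ne_zero.2 fun h => ?_
        refine hz.mul_ne_one (Fin.castAdd r j) (Fin.natAdd k l) ?_
        show z (Fin.castAdd r j) ^ 2 * z (Fin.natAdd k l) ^ 2 = 1
        rw [← h, mul_inv_cancel₀ (pow_ne_zero 2 (hz0 _))]
      have h0 := hz0 (Fin.castAdd r j)
      have he : c + 2 * ((k : ℤ) - (i : ℕ)) = (c + 2) + ((2 * (k - 1 - (i : ℕ)) : ℕ) : ℤ) := by
        omega
      rw [he, _root_.zpow_neg, _root_.zpow_neg, zpow_add₀ h0 (c + 2), zpow_natCast, pow_mul, mul_inv,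
        inv_pow, div_mul_eq_mul_div, mul_div_assoc, mul_div_cancel_right₀ _ h1, ← neg_div,
        div_mul_eq_mul_div, mul_div_assoc, mul_div_cancel_right₀ _ h2, neg_mul, sub_eq_add_neg]
    · simp only [submatrix_apply, finSumFinEquiv_apply_left, finSumFinEquiv_apply_right,
        fromBlocks_apply₁₂, hentry, interCoeff, rowPoly, Fin.val_castAdd, Fin.is_lt, if_true,
        Bool.false_eq_true, if_false, eval_mul, eval_pow, eval_X, eval_prod, eval_sub, eval_C,
        Fin.val_natAdd, not_lt.2 (Nat.le_add_right k _), zero_mul, add_zero, Matrix.zero_apply]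
      rw [Finset.prod_eq_zero (Finset.mem_univ j) (sub_self _), mul_zero, mul_zero]
    · rfl
    · simp only [submatrix_apply, finSumFinEquiv_apply_right, of_apply,
        fromBlocks_apply₂₂, hentry, interCoeff, rowPoly, if_true,
        Bool.false_eq_true, if_false, eval_pow, eval_X,
        Fin.val_natAdd, not_lt.2 (Nat.le_add_right k _), zero_mul, add_zero]
      congr 1
      rw [← zpow_natCast]
      congr 1
      omega
  have hD : det (of fun i j : Fin r => z (Fin.natAdd k j) ^ c *
      (z (Fin.natAdd k j) ^ 2) ^ ((r : ℤ) - 1 - (i : ℕ))) =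
      (∏ l, z (Fin.natAdd k l) ^ c) * vdm fun l => z (Fin.natAdd k l) ^ 2 := by
    rw [← det_rev_vandermonde, ← det_mul_row]
    rfl
  rw [← one_mul (interMatD k z fun _ => c).det, ← det_rowOp x, ← det_mul,
    ← det_submatrix_equiv_self finSumFinEquiv, hblock, det_fromBlocks_zero₁₂, hD]

lemma spInterD_const {z : Fin (k + r) → F} (hz : IsGeneric fun i => z i ^ 2) (c : ℤ) :
    spInterD k z (fun _ => c) = spD (fun i => z (Fin.castAdd r i)) (fun _ => c) *
      ∏ l : Fin r, z (Fin.natAdd k l) ^ c := by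
  have hinj : Function.Injective fun l : Fin r => z (Fin.natAdd k l) ^ 2 :=
    hz.injective.comp (Fin.natAdd_injective r k)
  have hv := vdm_ne_zero hinj
  rw [spInterD, det_interMatD_const hz, det_interMatD_const hz, spD]
  simp only [zpow_zero, Finset.prod_const_one, one_mul, zero_add]
  rw [← mul_assoc, mul_div_mul_right _ _ hv, mul_div_right_comm]

end Factorization

lemma sum_spInterD {n k : ℕ} (hk : k ≤ n) {z : Fin n → F} (hz : IsGeneric fun i => z i ^ 2)
    (a : ℤ) (M : ℕ) :
    ∑ l ∈ boxPart n (M + 1), spInterD k z (fun i => 2 * (2 * (l i : ℤ)) + a) =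
      spD z (fun _ => 2 * (M : ℤ)) * spInterD k z (fun _ => 2 * (M : ℤ) + a) := by
  have hz0 : ∀ i, z i ≠ 0 := fun i h => hz.ne_zero i (by simp [h])
  simp only [spInterD]
  rw [← Finset.sum_div, spD_const_eq, ← mul_div_assoc]
  congr 1
  have h1 := fun l : Fin n → ℕ => interMatD_eq hk hz0 a fun i => 2 * (l i : ℤ)
  have h2 := interMatD_eq hk hz0 a fun _ => (M : ℤ)
  simp only [h1, h2]
  exact sum_det_signed_alternant hz (interCoeff k z a) M

/-- **Theorem (main theorem, part (2)).**  For `1 ≤ n`, `0 ≤ k ≤ n`, `m` a positive even integer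
and `a = a2/2` a nonnegative half-integer, the sum of the intermediate symplectic characters
`sp^{(k,n-k)}_{λ+(a^n)}(x_1,…,x_k | x_{k+1},…,x_n)` over all partitions `λ ⊆ (m^n)` with all
parts even equals `sp_{((m/2)^n)}(x_1,…,x_n) · sp_{((m/2+a)^k)}(x_1,…,x_k) ·
(x_{k+1} ⋯ x_n)^{m/2+a}`, as an identity in `ℚ(x_1^{1/2}, …, x_n^{1/2})`.
Here `gen n i` plays the role of `x_i^{1/2}`, and all weights are doubled. -/
theorem sum_spInter_even_rectangle (n k m : ℕ) (a2 : ℤ) (hn : 1 ≤ n) (hk : k ≤ n)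
    (hm : 0 < m) (hme : Even m) (ha : 0 ≤ a2) :
    ∑ lam ∈ Finset.univ.filter
        (fun lam : Fin n → Fin (m + 1) =>
          (Antitone fun i => (lam i : ℕ)) ∧ ∀ i, Even (lam i : ℕ)),
      spInterD k (gen n) (fun i => 2 * ((lam i : ℕ) : ℤ) + a2) =
    spD (gen n) (fun _ => (m : ℤ)) *
      spD (fun i : Fin k => gen n (Fin.castLE hk i)) (fun _ => (m : ℤ) + a2) *
      ∏ i ∈ Finset.univ.filter (fun i : Fin n => k ≤ (i : ℕ)), gen n i ^ ((m : ℤ) + a2) := by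
  obtain ⟨M, rfl⟩ := even_iff_exists_two_mul.1 hme
  obtain ⟨r, rfl⟩ := Nat.exists_eq_add_of_le hk
  have hz := isGeneric_gen_sq (k + r)
  rw [sum_even_filter_eq_sum_boxPart (k + r) M fun w =>
    spInterD k (gen (k + r)) fun i => 2 * w i + a2]
  push_cast
  rw [sum_spInterD hk hz, spInterD_const hz, prod_filter_le_eq, ← mul_assoc]
  rfl
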